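/- Assume the set 𝔻 contains no cyclic subset, and let D_i, D_j ∈ 𝔻. Then the commutator [D_i, D_j] is either zero or a root derivation. More precisely: if ρ_i = ρ_j, or if ⟨ρ_i, e_j⟩ = 0 and ⟨ρ_j, e_i⟩ = 0, then [D_i, D_j] = 0; and if ⟨ρ_i, e_j⟩ > 0, then e_i + e_j is a Demazure root associated with ρ_j and [D_i, D_j] = D_{ψ, ρ_j, e_i + e_j} with ψ = ⟨ρ_i, e_j⟩·φ_i·φ_j. -/

import Mathlib

open scoped BigOperators

/-- `K₀(M)`: the fraction field of the group algebra `K₀[M]` of the lattice `M`. -/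
abbrev RatFunFld (K₀ : Type*) [Field K₀] (M : Type*) [AddCommGroup M] : Type _ :=
  FractionRing (AddMonoidAlgebra K₀ M)

/-- The monomial `χ^u` in `K₀(M)`, `u ∈ M`. -/
noncomputable def chi (K₀ : Type*) [Field K₀] {M : Type*} [AddCommGroup M] (u : M) :
    RatFunFld K₀ M :=
  algebraMap (AddMonoidAlgebra K₀ M) (RatFunFld K₀ M) (AddMonoidAlgebra.of' K₀ M u)

/-- A vector `ρ` of the dual lattice `N = Hom(M, ℤ)` is primitive. -/
def IsPrimitive {M : Type*} [AddCommGroup M] (ρ : M →+ ℤ) : Prop :=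
  ∀ (k : ℤ) (σ : M →+ ℤ), k • σ = ρ → IsUnit k

/-- `e ∈ M` is a Demazure root of the set of rays `rays = Σ(1) ⊆ N` associated with the
ray `ρ`: `⟨ρ, e⟩ = -1` and `⟨ρ', e⟩ ≥ 0` for all other rays `ρ'`. -/
def IsDemazureRoot {M : Type*} [AddCommGroup M] (rays : Finset (M →+ ℤ)) (e : M)
    (ρ : M →+ ℤ) : Prop :=
  ρ ∈ rays ∧ ρ e = -1 ∧ ∀ ρ' ∈ rays, ρ' ≠ ρ → 0 ≤ ρ' e

/-- `D` is the root derivation `D_{φ,ρ,e}`: the `K₀`-derivation of `K₀(M)` satisfying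
`D(χ^u) = φ·⟨ρ,u⟩·χ^{u+e}` for all `u ∈ M`. -/
def IsRootDerivation (K₀ : Type*) [Field K₀] {M : Type*} [AddCommGroup M]
    (D : Derivation K₀ (RatFunFld K₀ M) (RatFunFld K₀ M))
    (φ : K₀) (ρ : M →+ ℤ) (e : M) : Prop :=
  ∀ u : M, D (chi K₀ u) =
    algebraMap K₀ (RatFunFld K₀ M) φ * (ρ u : RatFunFld K₀ M) * chi K₀ (u + e)

/-- The sub-collection of root-derivation data `{(ρ_i, e_i)}` indexed by the list `l`
(a subset of the index set, listed in its cyclic order) is a cyclic set: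
`⟨ρ_{i+1}, e_i⟩ > 0` cyclically along `l`. -/
def IsCyclicList {M : Type*} [AddCommGroup M] {m : ℕ}
    (p : Fin m → (M →+ ℤ)) (e : Fin m → M) (l : List (Fin m)) : Prop :=
  l ≠ [] ∧ l.Nodup ∧ ∀ q ∈ l.zip (l.rotate 1), 0 < (p q.2) (e q.1)

/-- The sub-collection indexed by the list `l` (in its cyclic order) is almost simple:
for every `i` in the cycle, `⟨ρ_i, e_i⟩ = -1`, `⟨ρ_{i+1}, e_i⟩ = 1`, and `⟨ρ, e_i⟩ = 0`
for all rays `ρ` other than `ρ_i, ρ_{i+1}`. -/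
def IsAlmostSimpleList {M : Type*} [AddCommGroup M] (rays : Finset (M →+ ℤ)) {m : ℕ}
    (p : Fin m → (M →+ ℤ)) (e : Fin m → M) (l : List (Fin m)) : Prop :=
  l ≠ [] ∧ l.Nodup ∧ ∀ q ∈ l.zip (l.rotate 1),
    (p q.1) (e q.1) = -1 ∧ (p q.2) (e q.1) = 1 ∧
    ∀ ρ' ∈ rays, ρ' ≠ p q.1 → ρ' ≠ p q.2 → ρ' (e q.1) = 0

/-- The sub-collection indexed by `l` is simple: almost simple and the product of its
functions `φ_i` lies in (the image of) `𝕂`. -/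
def IsSimpleList (𝕂 : Type*) [Field 𝕂] {K₀ : Type*} [Field K₀] [Algebra 𝕂 K₀]
    {M : Type*} [AddCommGroup M] (rays : Finset (M →+ ℤ)) {m : ℕ}
    (φ : Fin m → K₀) (p : Fin m → (M →+ ℤ)) (e : Fin m → M) (l : List (Fin m)) : Prop :=
  IsAlmostSimpleList rays p e l ∧ ∃ c : 𝕂, algebraMap 𝕂 K₀ c = (l.map φ).prod

/-- A derivation of `K₀(M)` vanishing on all monomials is zero. -/
theorem derivation_eq_zero_of_chi {K₀ : Type*} [Field K₀] {M : Type*} [AddCommGroup M]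
    [IsDomain (AddMonoidAlgebra K₀ M)]
    (D : Derivation K₀ (RatFunFld K₀ M) (RatFunFld K₀ M))
    (h : ∀ u : M, D (chi K₀ u) = 0) : D = 0 := by
  have hA : ∀ a : AddMonoidAlgebra K₀ M, D (algebraMap _ (RatFunFld K₀ M) a) = 0 := by
    intro a
    induction a using AddMonoidAlgebra.induction_on with
    | of u => exact h u
    | add f g hf hg => rw [map_add, map_add, hf, hg, add_zero]
    | smul r f hf =>
      rw [Algebra.algebraMap_eq_smul_one, smul_assoc, ← Algebra.algebraMap_eq_smul_one,
        D.map_smul, hf, smul_zero]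
  ext x
  obtain ⟨a, b, -, rfl⟩ := IsFractionRing.div_surjective (A := AddMonoidAlgebra K₀ M) x
  simp [div_eq_mul_inv, Derivation.leibniz, Derivation.leibniz_inv, hA]

/-- The commutator of two root derivations, evaluated on a monomial. -/
theorem IsRootDerivation.commutator_chi {K₀ : Type*} [Field K₀] {M : Type*} [AddCommGroup M]
    [IsDomain (AddMonoidAlgebra K₀ M)]
    {D₁ D₂ : Derivation K₀ (RatFunFld K₀ M) (RatFunFld K₀ M)}
    {φ₁ φ₂ : K₀} {ρ₁ ρ₂ : M →+ ℤ} {e₁ e₂ : M}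
    (h₁ : IsRootDerivation K₀ D₁ φ₁ ρ₁ e₁) (h₂ : IsRootDerivation K₀ D₂ φ₂ ρ₂ e₂) (u : M) :
    ⁅D₁, D₂⁆ (chi K₀ u) =
      algebraMap K₀ (RatFunFld K₀ M) (φ₁ * φ₂) *
        ((ρ₁ e₂ * ρ₂ u - ρ₂ e₁ * ρ₁ u : ℤ) : RatFunFld K₀ M) * chi K₀ (u + (e₁ + e₂)) := by
  have hu : u + e₂ + e₁ = u + (e₁ + e₂) := by abel
  have hu' : u + e₁ + e₂ = u + (e₁ + e₂) := by abel
  rw [Derivation.commutator_apply, h₁ u, h₂ u]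
  simp only [Derivation.leibniz, Derivation.map_algebraMap, Derivation.map_intCast,
    smul_eq_mul, h₁ _, h₂ _, hu, hu', map_add, map_mul]
  push_cast
  ring

/-- If `⟨ρ₁, e₂⟩ > 0` and `⟨ρ₂, e₁⟩ = 0`, then the sum of the roots is a root for `ρ₂`. -/
theorem IsDemazureRoot.add {M : Type*} [AddCommGroup M] {rays : Finset (M →+ ℤ)}
    {e₁ e₂ : M} {ρ₁ ρ₂ : M →+ ℤ} (h₁ : IsDemazureRoot rays e₁ ρ₁)
    (h₂ : IsDemazureRoot rays e₂ ρ₂) (hpos : 0 < ρ₁ e₂) (hzero : ρ₂ e₁ = 0) :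
    IsDemazureRoot rays (e₁ + e₂) ρ₂ := by
  refine ⟨h₂.1, by rw [map_add, hzero, h₂.2.1, zero_add], fun ρ' hρ' hne => ?_⟩
  rw [map_add]
  by_cases h : ρ' = ρ₁
  · subst h
    have := h₁.2.1
    omega
  · exact add_nonneg (h₁.2.2 ρ' hρ' h) (h₂.2.2 ρ' hρ' hne)

/-- In a family of roots without cyclic subsets, `⟨ρ_i, e_j⟩ > 0` forces `⟨ρ_j, e_i⟩ = 0`. -/
theorem pairing_eq_zero_of_noncyclic {M : Type*} [AddCommGroup M] {rays : Finset (M →+ ℤ)}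
    {m : ℕ} {p : Fin m → (M →+ ℤ)} {e : Fin m → M}
    (hroot : ∀ i, IsDemazureRoot rays (e i) (p i))
    (hnocyc : ∀ l : List (Fin m), ¬ IsCyclicList p e l) {i j : Fin m}
    (hpos : 0 < p i (e j)) : p j (e i) = 0 := by
  have hne : p j ≠ p i := by
    intro h
    have := (hroot j).2.1
    rw [h] at this
    omega
  have hij : i ≠ j := by
    rintro rfl
    exact hne rfl
  refine le_antisymm (not_lt.mp fun hlt => hnocyc [i, j] ⟨by simp, by simp [hij], ?_⟩)
    ((hroot i).2.2 _ (hroot j).1 hne)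
  simp [hlt, hpos]

/-- The commutator of two root derivations with `⟨ρ₂, e₁⟩ = 0` is a root derivation. -/
theorem IsRootDerivation.commutator {K₀ : Type*} [Field K₀] {M : Type*} [AddCommGroup M]
    [IsDomain (AddMonoidAlgebra K₀ M)]
    {D₁ D₂ : Derivation K₀ (RatFunFld K₀ M) (RatFunFld K₀ M)}
    {φ₁ φ₂ : K₀} {ρ₁ ρ₂ : M →+ ℤ} {e₁ e₂ : M}
    (h₁ : IsRootDerivation K₀ D₁ φ₁ ρ₁ e₁) (h₂ : IsRootDerivation K₀ D₂ φ₂ ρ₂ e₂)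
    (hzero : ρ₂ e₁ = 0) :
    IsRootDerivation K₀ ⁅D₁, D₂⁆ (((ρ₁ e₂ : ℤ) : K₀) * φ₁ * φ₂) ρ₂ (e₁ + e₂) := by
  intro u
  rw [h₁.commutator_chi h₂, hzero]
  simp only [map_mul, map_intCast, zero_mul, sub_zero]
  push_cast
  ring

/-- Lemma `lemcom`. Assume `𝔻 = {D_{φ_i,ρ_i,e_i}}_{i=1}^m` contains no
cyclic subset. Then for all `i, j` the commutator `[D_i, D_j]` is either zero or a root
derivation; more precisely: if `ρ_i = ρ_j`, or `⟨ρ_i, e_j⟩ = 0 = ⟨ρ_j, e_i⟩`, then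
`[D_i, D_j] = 0`; and if `⟨ρ_i, e_j⟩ > 0`, then `e_i + e_j` is a Demazure root associated
with `ρ_j` and `[D_i, D_j] = D_{ψ, ρ_j, e_i + e_j}` with `ψ = ⟨ρ_i, e_j⟩·φ_i·φ_j`. -/
theorem commutator_in_noncyclic_family
    (𝕂 : Type*) [Field 𝕂] [IsAlgClosed 𝕂] [CharZero 𝕂]
    (K₀ : Type*) [Field K₀] [Algebra 𝕂 K₀]
    (M : Type*) [AddCommGroup M] [Module.Free ℤ M] [Module.Finite ℤ M]
    [IsDomain (AddMonoidAlgebra K₀ M)]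
    (rays : Finset (M →+ ℤ)) (hprim : ∀ ρ ∈ rays, IsPrimitive ρ)
    {m : ℕ} (hm : 2 ≤ m)
    (D : Fin m → Derivation K₀ (RatFunFld K₀ M) (RatFunFld K₀ M))
    (φ : Fin m → K₀) (p : Fin m → (M →+ ℤ)) (e : Fin m → M)
    (hroot : ∀ i, IsDemazureRoot rays (e i) (p i))
    (hD : ∀ i, IsRootDerivation K₀ (D i) (φ i) (p i) (e i))
    (hφ : ∀ i, φ i ≠ 0)
    (hnp : ∀ i j : Fin m, i ≠ j → ∀ c : K₀,
      ⇑(D j) ≠ fun x => algebraMap K₀ (RatFunFld K₀ M) c * D i x)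
    (hnocyc : ∀ l : List (Fin m), ¬ IsCyclicList p e l)
    (i j : Fin m) :
    (⁅D i, D j⁆ = 0 ∨
      ∃ (ψ : K₀) (ρhat : M →+ ℤ) (ehat : M),
        IsDemazureRoot rays ehat ρhat ∧ IsRootDerivation K₀ ⁅D i, D j⁆ ψ ρhat ehat) ∧
    ((p i = p j ∨ ((p i) (e j) = 0 ∧ (p j) (e i) = 0)) → ⁅D i, D j⁆ = 0) ∧
    (0 < (p i) (e j) →
      IsDemazureRoot rays (e i + e j) (p j) ∧
      IsRootDerivation K₀ ⁅D i, D j⁆ ((((p i) (e j) : ℤ) : K₀) * φ i * φ j)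
        (p j) (e i + e j)) := by
  have hzero : (p i = p j ∨ (p i (e j) = 0 ∧ p j (e i) = 0)) → ⁅D i, D j⁆ = 0 := by
    intro h
    refine derivation_eq_zero_of_chi _ fun u => ?_
    rw [(hD i).commutator_chi (hD j)]
    rcases h with h | ⟨hij, hji⟩
    · have hi := (hroot i).2.1
      have hj := (hroot j).2.1
      rw [h] at hi
      simp [h, hi, hj]
    · simp [hij, hji]
  have hcomm : ∀ {i j : Fin m}, 0 < p i (e j) →
      IsDemazureRoot rays (e i + e j) (p j) ∧
      IsRootDerivation K₀ ⁅D i, D j⁆ (((p i (e j) : ℤ) : K₀) * φ i * φ j)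
        (p j) (e i + e j) := by
    intro i j hpos
    have hji := pairing_eq_zero_of_noncyclic hroot hnocyc hpos
    exact ⟨(hroot i).add (hroot j) hpos hji, (hD i).commutator (hD j) hji⟩
  refine ⟨?_, hzero, hcomm⟩
  by_cases hp : p i = p j
  · exact Or.inl (hzero (Or.inl hp))
  rcases ((hroot j).2.2 _ (hroot i).1 hp).lt_or_eq with hij | hij
  · exact Or.inr ⟨_, _, _, hcomm hij⟩
  rcases ((hroot i).2.2 _ (hroot j).1 (Ne.symm hp)).lt_or_eq with hji | hji
  · obtain ⟨hr, hd⟩ := hcomm hji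
    refine Or.inr ⟨-(((p j (e i) : ℤ) : K₀) * φ j * φ i), _, _, hr, fun u => ?_⟩
    rw [← lie_skew, Derivation.neg_apply, hd u, map_neg, neg_mul, neg_mul]
  · exact Or.inl (hzero (Or.inr ⟨hij.symm, hji.symm⟩))
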